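/- (Bramble–Hilbert estimate.) Let n, k, m be natural numbers with m ≤ k+1, and let γ > 0. There is a constant C, depending only on n, k and γ, with the following property: for every bounded open set e ⊂ ℝⁿ of diameter h_e that is star-shaped with respect to some ball of radius h_e/γ contained in e, and for every function u ∈ C^{k+1} on a neighborhood of the closure of e whose (k+1)-st total derivative is square-integrable on e, there exists a polynomial P_e of degree at most k (in n variables) such that ‖∇^m(u − P_e)‖_{L²(e)} ≤ C · h_e^{k+1−m} · ‖∇^{k+1} u‖_{L²(e)}. -/

import Mathlib

open MeasureTheory

/-- The local Sobolev seminorm `‖∇^m f‖_{L²(s)}`. -/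
noncomputable def sobolevSeminorm (n m : ℕ) (s : Set (EuclideanSpace ℝ (Fin n)))
    (f : EuclideanSpace ℝ (Fin n) → ℝ) : ℝ :=
  Real.sqrt (∫ x in s, ‖iteratedFDeriv ℝ m f x‖ ^ 2)

theorem bh_swap {E : Type*} [NormedAddCommGroup E] [NormedSpace ℝ E] (u : E → ℝ) :
    ∀ (j : ℕ) (x : E), ContDiffAt ℝ ((j + 1 : ℕ) : WithTop ℕ∞) u x → ∀ (i : Fin j) (v : Fin (j + 1) → E),
      iteratedFDeriv ℝ (j + 1) u x (v ∘ Equiv.swap i.castSucc i.succ)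
        = iteratedFDeriv ℝ (j + 1) u x v := by
  intro j
  induction j with
  | zero => intro x _ i; exact i.elim0
  | succ j ih =>
    intro x hx i v
    have hd : DifferentiableAt ℝ (iteratedFDeriv ℝ (j + 1) u) x :=
      (hx.iteratedFDeriv_right (m := 1) (i := j + 1) (by norm_cast; omega)).differentiableAt (by norm_num)
    refine Fin.cases ?_ (fun i => ?_) i
    · have h2 : ContDiffAt ℝ ((2 : ℕ) : WithTop ℕ∞) (iteratedFDeriv ℝ j u) x :=
        hx.iteratedFDeriv_right (m := ((2 : ℕ) : WithTop ℕ∞)) (i := j) (by norm_cast; omega)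
      have hd2 : DifferentiableAt ℝ (fderiv ℝ (iteratedFDeriv ℝ j u)) x :=
        (h2.fderiv_right (m := 1) (by norm_num)).differentiableAt (by norm_num)
      have key : ∀ w : Fin (j + 2) → E, iteratedFDeriv ℝ (j + 2) u x w =
          fderiv ℝ (fderiv ℝ (iteratedFDeriv ℝ j u)) x (w 0) (w 1) (Fin.tail (Fin.tail w)) := by
        intro w
        rw [hd.iteratedFDeriv_succ_apply_left']
        have : (fun y => iteratedFDeriv ℝ (j + 1) u y (Fin.tail w)) =
            fun y => fderiv ℝ (iteratedFDeriv ℝ j u) y (w 1) (Fin.tail (Fin.tail w)) := by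
          ext y
          rw [iteratedFDeriv_succ_apply_left]; rfl
        rw [this]
        have h3 : HasFDerivAt (fun y => fderiv ℝ (iteratedFDeriv ℝ j u) y (w 1)) _ x :=
          hd2.hasFDerivAt.clm_apply (hasFDerivAt_const (w 1) x)
        have h4 := ((ContinuousMultilinearMap.apply ℝ (fun _ : Fin j => E) ℝ
          (Fin.tail (Fin.tail w))).hasFDerivAt.comp x h3).fderiv
        change fderiv ℝ (fun y => fderiv ℝ (iteratedFDeriv ℝ j u) y (w 1) (Fin.tail (Fin.tail w))) x = _ at h4
        rw [h4]
        simp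
      rw [key, key]
      have hs := (h2.isSymmSndFDerivAt (by simp)) (v 0) (v 1)
      have e0 : (v ∘ Equiv.swap (Fin.castSucc (0 : Fin (j + 1))) (Fin.succ 0)) 0 = v 1 := by
        simp
      have e1 : (v ∘ Equiv.swap (Fin.castSucc (0 : Fin (j + 1))) (Fin.succ 0)) 1 = v 0 := by
        simp
      have e2 : Fin.tail (Fin.tail (v ∘ Equiv.swap (Fin.castSucc (0 : Fin (j + 1))) (Fin.succ 0)))
          = Fin.tail (Fin.tail v) := by
        ext l
        simp only [Fin.tail, Function.comp]
        rw [Equiv.swap_apply_of_ne_of_ne]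
        · simp [Fin.ext_iff]
        · simp [Fin.ext_iff]
      rw [e0, e1, e2, hs]
    · rw [hd.iteratedFDeriv_succ_apply_left', hd.iteratedFDeriv_succ_apply_left']
      have e0 : (v ∘ Equiv.swap (Fin.castSucc i.succ) (Fin.succ i.succ)) 0 = v 0 := by
        simp only [Function.comp]
        rw [Equiv.swap_apply_of_ne_of_ne]
        · simp [Fin.ext_iff]
        · simp [Fin.ext_iff]
      have e1 : Fin.tail (v ∘ Equiv.swap (Fin.castSucc i.succ) (Fin.succ i.succ))
          = Fin.tail v ∘ Equiv.swap (Fin.castSucc i) (Fin.succ i) := by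
        ext l
        simp only [Fin.tail, Function.comp, Equiv.swap_apply_def, Fin.ext_iff]
        simp only [Fin.val_succ, Fin.val_castSucc, add_left_inj]
        split_ifs <;> rfl
      rw [e0, e1]
      congr 1
      apply Filter.EventuallyEq.fderiv_eq
      have hev : ∀ᶠ y in nhds x, ContDiffAt ℝ ((j + 1 : ℕ) : WithTop ℕ∞) u y :=
        (hx.of_le (by norm_cast; omega)).eventually (by simp)
      filter_upwards [hev] with y hy using ih y hy i _

theorem bh_perm {E : Type*} [NormedAddCommGroup E] [NormedSpace ℝ E] (u : E → ℝ)
    (j : ℕ) (x : E) (hx : ContDiffAt ℝ (j : WithTop ℕ∞) u x) (σ : Equiv.Perm (Fin j)) (v : Fin j → E) :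
      iteratedFDeriv ℝ j u x (v ∘ σ) = iteratedFDeriv ℝ j u x v := by
  cases j with
  | zero => congr 1; ext i; exact i.elim0
  | succ j =>
    have hσ : σ ∈ Submonoid.closure (Set.range fun i : Fin j => Equiv.swap i.castSucc i.succ) := by
      rw [Equiv.Perm.mclosure_swap_castSucc_succ]; trivial
    induction hσ using Submonoid.closure_induction generalizing v with
    | mem a ha => obtain ⟨i, rfl⟩ := ha; exact bh_swap u j x hx i v
    | one => rfl
    | mul a b _ _ ha hb =>
      rw [Equiv.Perm.coe_mul, ← Function.comp_assoc, hb, ha]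

theorem bh_taylor (n k : ℕ) (u : EuclideanSpace ℝ (Fin n) → ℝ) (y : EuclideanSpace ℝ (Fin n))
    (hu : ContDiffAt ℝ ((k + 1 : ℕ) : WithTop ℕ∞) u y) :
    ∃ P : MvPolynomial (Fin n) ℝ, P.totalDegree ≤ k ∧
      ContDiff ℝ ((k + 1 : ℕ) : WithTop ℕ∞)
        (fun x : EuclideanSpace ℝ (Fin n) => MvPolynomial.eval (fun i => x i) P) ∧
      (∀ j ≤ k, iteratedFDeriv ℝ j
        (fun x : EuclideanSpace ℝ (Fin n) => MvPolynomial.eval (fun i => x i) P) y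
          = iteratedFDeriv ℝ j u y) ∧
      ∀ x, iteratedFDeriv ℝ (k + 1)
        (fun x : EuclideanSpace ℝ (Fin n) => MvPolynomial.eval (fun i => x i) P) x = 0 := by
  let q : FormalMultilinearSeries ℝ (EuclideanSpace ℝ (Fin n)) ℝ := fun j =>
    if j ≤ k then ((j.factorial : ℝ)⁻¹) • iteratedFDeriv ℝ j u y else 0
  let b : Fin n → EuclideanSpace ℝ (Fin n) := fun i => EuclideanSpace.single i 1
  let P : MvPolynomial (Fin n) ℝ := ∑ j ∈ Finset.range (k + 1), ∑ r : Fin j → Fin n,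
    MvPolynomial.C (q j (fun l => b (r l))) *
      ∏ l, (MvPolynomial.X (r l) - MvPolynomial.C (y (r l)))
  have hP : ∀ w : EuclideanSpace ℝ (Fin n), MvPolynomial.eval (fun i => (y + w) i) P =
      ∑ j ∈ Finset.range (k + 1), q j (fun _ => w) := by
    intro w
    simp only [P, map_sum, map_mul, MvPolynomial.eval_C, map_prod, map_sub, MvPolynomial.eval_X]
    refine Finset.sum_congr rfl fun j _ => ?_
    have hw : w = ∑ i, w i • b i := by
      ext i
      simp [b, Pi.single_apply]
    conv_rhs => rw [hw]
    rw [(q j).map_sum]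
    refine Finset.sum_congr rfl fun r _ => ?_
    rw [ContinuousMultilinearMap.map_smul_univ]
    simp [mul_comm]
  have hF : HasFiniteFPowerSeriesOnBall
      (fun x : EuclideanSpace ℝ (Fin n) => MvPolynomial.eval (fun i => x i) P) q y (k + 1) ⊤ := by
    refine HasFiniteFPowerSeriesOnBall.mk' ?_ (by simp) ?_
    · intro m hm
      simp only [q]; rw [if_neg (by omega)]
    · intro w _
      exact (hP w).symm
  refine ⟨P, ?_, ?_, ?_, ?_⟩
  · refine MvPolynomial.totalDegree_finsetSum_le fun j hj => ?_
    refine MvPolynomial.totalDegree_finsetSum_le fun r _ => ?_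
    refine (MvPolynomial.totalDegree_mul _ _).trans ?_
    rw [MvPolynomial.totalDegree_C, zero_add]
    refine (MvPolynomial.totalDegree_finsetProd _ _).trans ?_
    refine (Finset.sum_le_card_nsmul _ _ 1 fun l _ => ?_).trans ?_
    · refine (MvPolynomial.totalDegree_sub_C_le _ _).trans ?_
      simp
    · have := Finset.mem_range.1 hj
      simp; omega
  · rw [contDiff_iff_contDiffAt]
    intro x
    have := (hF.changeOrigin (y := x - y) (by simp)).cpolynomialAt.analyticAt.contDiffAt
      (n := ((k + 1 : ℕ) : WithTop ℕ∞))
    simpa using this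
  · intro j hj
    ext v
    rw [hF.toHasFPowerSeriesOnBall.iteratedFDeriv_eq_sum_of_completeSpace]
    simp only [q, if_pos hj]
    have : ∀ σ : Equiv.Perm (Fin j), ((j.factorial : ℝ)⁻¹ • iteratedFDeriv ℝ j u y)
        (fun i => v (σ i)) = (j.factorial : ℝ)⁻¹ * iteratedFDeriv ℝ j u y v := by
      intro σ
      have := bh_perm u j y (hu.of_le (by norm_cast; omega)) σ v
      simp only [smul_apply, smul_eq_mul]
      rw [← this]; rfl
    rw [Finset.sum_congr rfl (fun σ _ => this σ)]
    simp [Fintype.card_perm]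
    field_simp
  · intro x
    ext v
    have h := hF.changeOrigin (y := x - y) (by simp)
    have h2 := h.toHasFPowerSeriesOnBall.iteratedFDeriv_eq_sum_of_completeSpace (n := k + 1) v
    rw [h.finite (k + 1) le_rfl] at h2
    simpa using h2

theorem bh_pointwise {E : Type*} [NormedAddCommGroup E] [NormedSpace ℝ E] (k : ℕ) (g : E → ℝ)
    (x y : E) (hg : ∀ p ∈ segment ℝ y x, ContDiffAt ℝ ((k + 1 : ℕ) : WithTop ℕ∞) g p)
    (h0 : ∀ j ≤ k, iteratedFDeriv ℝ j g y = 0) (i : ℕ) (hi : i ≤ k) :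
    ∀ p ∈ segment ℝ y x, ‖iteratedFDeriv ℝ (k - i) g p‖ ≤ ‖x - y‖ ^ (i + 1) *
      ∫ s in (0 : ℝ)..1, ‖iteratedFDeriv ℝ (k + 1) g (y + s • (x - y))‖ := by
  have hd : ∀ j ≤ k, ∀ p ∈ segment ℝ y x, DifferentiableAt ℝ (iteratedFDeriv ℝ j g) p :=
    fun j hj p hp => (hg p hp).differentiableAt_iteratedFDeriv (by norm_cast; omega)
  have hmem : ∀ s ∈ Set.Icc (0 : ℝ) 1, y + s • (x - y) ∈ segment ℝ y x := by
    intro s hs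
    rw [segment_eq_image']
    exact ⟨s, hs, rfl⟩
  have hcont : ∀ s ∈ Set.Icc (0 : ℝ) 1,
      ContinuousAt (fun s : ℝ => iteratedFDeriv ℝ (k + 1) g (y + s • (x - y))) s := by
    intro s hs
    have h1 : ContinuousAt (iteratedFDeriv ℝ (k + 1) g) (y + s • (x - y)) :=
      ((hg _ (hmem s hs)).iteratedFDeriv_right (m := 0) (i := k + 1) (by simp)).continuousAt
    exact ContinuousAt.comp (f := fun s : ℝ => y + s • (x - y)) h1 (by fun_prop)
  induction i with
  | zero =>
    intro p hp
    rw [segment_eq_image'] at hp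
    obtain ⟨t, ht, rfl⟩ := hp
    have hsub : Set.uIcc 0 t ⊆ Set.Icc (0 : ℝ) 1 := by
      rw [Set.uIcc_of_le ht.1]; exact Set.Icc_subset_Icc_right ht.2
    have hder : ∀ s ∈ Set.uIcc 0 t, HasDerivAt (fun s : ℝ => iteratedFDeriv ℝ k g (y + s • (x - y)))
        (fderiv ℝ (iteratedFDeriv ℝ k g) (y + s • (x - y)) (x - y)) s := by
      intro s hs
      have h1 : HasDerivAt (fun s : ℝ => y + s • (x - y)) (x - y) s := by
        simpa using ((hasDerivAt_id s).smul_const (x - y)).const_add y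
      exact (hd k le_rfl _ (hmem s (hsub hs))).hasFDerivAt.comp_hasDerivAt s h1
    have hcd : ContinuousOn (fun s : ℝ => fderiv ℝ (iteratedFDeriv ℝ k g) (y + s • (x - y)) (x - y))
        (Set.uIcc 0 t) := by
      intro s hs
      have h1 : ContinuousAt (fderiv ℝ (iteratedFDeriv ℝ k g)) (y + s • (x - y)) :=
        (((hg _ (hmem s (hsub hs))).iteratedFDeriv_right (m := 1) (i := k)
          (by norm_cast; omega)).fderiv_right (m := 0) (by norm_num)).continuousAt
      have h2 : ContinuousAt (fun s : ℝ => fderiv ℝ (iteratedFDeriv ℝ k g) (y + s • (x - y))) s :=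
        ContinuousAt.comp (f := fun s : ℝ => y + s • (x - y)) h1 (by fun_prop)
      exact (h2.clm_apply continuousAt_const).continuousWithinAt
    have hftc := intervalIntegral.integral_eq_sub_of_hasDerivAt hder hcd.intervalIntegrable
    simp only [zero_smul, add_zero, h0 k le_rfl, sub_zero] at hftc
    have hn : ContinuousOn (fun s : ℝ => ‖iteratedFDeriv ℝ (k + 1) g (y + s • (x - y))‖)
      (Set.Icc 0 1) := fun s hs => (hcont s hs).norm.continuousWithinAt
    rw [Nat.sub_zero, ← hftc, zero_add, pow_one]
    calc _ ≤ ∫ s in (0:ℝ)..t, ‖x - y‖ * ‖iteratedFDeriv ℝ (k + 1) g (y + s • (x - y))‖ := by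
          refine intervalIntegral.norm_integral_le_of_norm_le ht.1 ?_ ?_
          · refine Filter.Eventually.of_forall fun s _ => ?_
            rw [← norm_fderiv_iteratedFDeriv, mul_comm]
            exact ContinuousLinearMap.le_opNorm _ _
          · exact (continuousOn_const.mul (hn.mono hsub)).intervalIntegrable
      _ = ‖x - y‖ * ∫ s in (0:ℝ)..t, ‖iteratedFDeriv ℝ (k + 1) g (y + s • (x - y))‖ := by
          rw [intervalIntegral.integral_const_mul]
      _ ≤ _ := by
          refine mul_le_mul_of_nonneg_left ?_ (norm_nonneg _)
          refine intervalIntegral.integral_mono_interval le_rfl ht.1 ht.2 ?_ ?_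
          · exact Filter.Eventually.of_forall fun s => norm_nonneg _
          · refine ContinuousOn.intervalIntegrable ?_
            rwa [Set.uIcc_of_le zero_le_one]
  | succ i ih =>
    intro p hp
    have ih := ih (by omega)
    have hk : k - i = k - (i + 1) + 1 := by omega
    have hmv := Convex.norm_image_sub_le_of_norm_hasFDerivWithin_le
      (f := iteratedFDeriv ℝ (k - (i + 1)) g) (s := segment ℝ y x)
      (f' := fderiv ℝ (iteratedFDeriv ℝ (k - (i + 1)) g))
      (fun p hp => (hd _ (by omega) p hp).hasFDerivAt.hasFDerivWithinAt)
      (C := ‖x - y‖ ^ (i + 1) *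
        ∫ s in (0 : ℝ)..1, ‖iteratedFDeriv ℝ (k + 1) g (y + s • (x - y))‖)
      (by
        intro p hp
        rw [norm_fderiv_iteratedFDeriv, ← hk]
        exact ih p hp) (convex_segment y x) (left_mem_segment ℝ y x) hp
    rw [h0 _ (by omega), sub_zero] at hmv
    refine hmv.trans ?_
    have hle : ‖p - y‖ ≤ ‖x - y‖ := by
      rw [segment_eq_image'] at hp
      obtain ⟨t, ht, rfl⟩ := hp
      simp only [add_sub_cancel_left, norm_smul, Real.norm_eq_abs, abs_of_nonneg ht.1]
      exact mul_le_of_le_one_left (norm_nonneg _) ht.2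
    have hI : 0 ≤ ∫ s in (0 : ℝ)..1, ‖iteratedFDeriv ℝ (k + 1) g (y + s • (x - y))‖ :=
      intervalIntegral.integral_nonneg zero_le_one fun _ _ => norm_nonneg _
    calc _ ≤ _ * ‖x - y‖ := mul_le_mul_of_nonneg_left hle (by positivity)
      _ = _ := by ring

theorem bh_cs (φ : ℝ → ℝ) (hφ : ContinuousOn φ (Set.Icc 0 1)) :
    (∫ s in (0 : ℝ)..1, φ s) ^ 2 ≤ ∫ s in (0 : ℝ)..1, φ s ^ 2 := by
  set c := ∫ s in (0 : ℝ)..1, φ s with hc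
  have hφ' : ContinuousOn φ (Set.uIcc 0 1) := by rwa [Set.uIcc_of_le zero_le_one]
  have h1 : 0 ≤ ∫ s in (0 : ℝ)..1, (φ s - c) ^ 2 :=
    intervalIntegral.integral_nonneg zero_le_one fun _ _ => sq_nonneg _
  have h2 : ∫ s in (0 : ℝ)..1, (φ s - c) ^ 2 = ∫ s in (0 : ℝ)..1, (φ s ^ 2 - (2 * c) * φ s + c ^ 2) := by
    congr 1; ext s; ring
  have i1 : IntervalIntegrable (fun s => φ s ^ 2) volume 0 1 := (hφ'.pow 2).intervalIntegrable
  have i2 : IntervalIntegrable (fun s => (2 * c) * φ s) volume 0 1 :=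
    (continuousOn_const.mul hφ').intervalIntegrable
  rw [h2, intervalIntegral.integral_add (i1.sub i2) (by simp),
    intervalIntegral.integral_sub i1 i2, intervalIntegral.integral_const_mul, ← hc] at h1
  simp at h1
  nlinarith

theorem bh_scale (n : ℕ) (F : EuclideanSpace ℝ (Fin n) → ENNReal) (hF : Measurable F)
    (a : EuclideanSpace ℝ (Fin n)) (s : ℝ) (hs : 1 / 2 ≤ s) :
    ∫⁻ x, F (a + s • x) ≤ 2 ^ n * ∫⁻ x, F x := by
  have hs0 : s ≠ 0 := by linarith
  have h1 : ∫⁻ x, F (a + s • x) = ∫⁻ x, F (a + x) ∂(Measure.map (s • ·) volume) := by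
    rw [lintegral_map (by fun_prop) (by fun_prop)]
  rw [h1, Measure.map_addHaar_smul _ hs0, lintegral_smul_measure, lintegral_add_left_eq_self,
    finrank_euclideanSpace_fin, smul_eq_mul]
  gcongr
  have : |(s ^ n)⁻¹| ≤ 2 ^ n := by
    rw [abs_of_nonneg (by positivity), ← inv_pow]
    refine pow_le_pow_left₀ (by positivity) ?_ n
    rw [inv_le_comm₀ (by linarith) (by norm_num)]
    linarith
  calc _ ≤ ENNReal.ofReal (2 ^ n) := ENNReal.ofReal_le_ofReal this
    _ = _ := by rw [ENNReal.ofReal_pow (by norm_num)]; simp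

theorem bh_avg (n : ℕ) (F : EuclideanSpace ℝ (Fin n) → ENNReal) (hF : Measurable F)
    (B e : Set (EuclideanSpace ℝ (Fin n))) (hB : volume B ≠ 0) (hB' : volume B ≠ ⊤)
    (L : ENNReal) (he : volume e ≤ L * volume B) :
    ∃ y ∈ B, ∫⁻ x in e, ∫⁻ s in Set.Icc (0 : ℝ) 1, F (y + s • (x - y))
      ≤ 2 ^ n * (1 + L) * ∫⁻ x, F x := by
  have hm : Measurable fun p : (EuclideanSpace ℝ (Fin n) × EuclideanSpace ℝ (Fin n)) × ℝ =>
      F (p.1.1 + p.2 • (p.1.2 - p.1.1)) := hF.comp (by fun_prop)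
  have hs : ∀ s ∈ Set.Icc (0 : ℝ) 1, ∫⁻ y in B, ∫⁻ x in e, F (y + s • (x - y)) ≤
      2 ^ n * (1 + L) * (∫⁻ x, F x) * volume B := by
    intro s hs
    by_cases h : 1 / 2 ≤ s
    · calc _ ≤ ∫⁻ y in B, 2 ^ n * ∫⁻ x, F x := by
            refine lintegral_mono fun y => ?_
            refine (setLIntegral_le_lintegral _ _).trans ?_
            have := bh_scale n F hF (y - s • y) s h
            refine le_of_eq_of_le (lintegral_congr fun x => ?_) this
            congr 1
            module
        _ = 2 ^ n * 1 * (∫⁻ x, F x) * volume B := by simp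
        _ ≤ _ := by gcongr; exact le_self_add
    · rw [lintegral_lintegral_swap (by
        exact (hF.comp (g := F) (f := fun p : EuclideanSpace ℝ (Fin n) × EuclideanSpace ℝ (Fin n) =>
          p.1 + s • (p.2 - p.1)) (by fun_prop)).aemeasurable)]
      calc _ ≤ ∫⁻ x in e, 2 ^ n * ∫⁻ x, F x := by
            refine lintegral_mono fun x => ?_
            refine (setLIntegral_le_lintegral _ _).trans ?_
            have := bh_scale n F hF (s • x) (1 - s) (by linarith)
            refine le_of_eq_of_le (lintegral_congr fun y => ?_) this
            congr 1
            module
        _ = 2 ^ n * (∫⁻ x, F x) * volume e := by simp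
        _ ≤ 2 ^ n * (∫⁻ x, F x) * (L * volume B) := by gcongr
        _ = 2 ^ n * L * (∫⁻ x, F x) * volume B := by ring
        _ ≤ _ := by gcongr; exact le_add_self
  have hm2 : Measurable fun y => ∫⁻ x in e, ∫⁻ s in Set.Icc (0 : ℝ) 1, F (y + s • (x - y)) := by
    have h1 : Measurable fun p : EuclideanSpace ℝ (Fin n) × EuclideanSpace ℝ (Fin n) =>
      ∫⁻ s in Set.Icc (0 : ℝ) 1, F (p.1 + s • (p.2 - p.1)) := hm.lintegral_prod_right'
    exact h1.lintegral_prod_right'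
  obtain ⟨y, hy, hle⟩ := exists_le_setLAverage hB hB' hm2.aemeasurable
  refine ⟨y, hy, hle.trans ?_⟩
  rw [setLAverage_eq]
  refine ENNReal.div_le_of_le_mul ?_
  calc _ = ∫⁻ y in B, ∫⁻ s in Set.Icc (0 : ℝ) 1, ∫⁻ x in e, F (y + s • (x - y)) := by
        refine lintegral_congr fun y => ?_
        exact lintegral_lintegral_swap (hF.comp (g := F) (f := fun p : EuclideanSpace ℝ (Fin n) × ℝ =>
          y + p.2 • (p.1 - y)) (by fun_prop)).aemeasurable
    _ = ∫⁻ s in Set.Icc (0 : ℝ) 1, ∫⁻ y in B, ∫⁻ x in e, F (y + s • (x - y)) := by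
        refine lintegral_lintegral_swap (Measurable.aemeasurable ?_)
        have h1 : Measurable fun p : (EuclideanSpace ℝ (Fin n) × ℝ) × EuclideanSpace ℝ (Fin n) =>
          F (p.1.1 + p.1.2 • (p.2 - p.1.1)) := hF.comp (by fun_prop)
        exact h1.lintegral_prod_right'
    _ ≤ ∫⁻ s in Set.Icc (0 : ℝ) 1, 2 ^ n * (1 + L) * (∫⁻ x, F x) * volume B :=
        setLIntegral_mono' measurableSet_Icc hs
    _ = _ := by simp

theorem bh_good_point (n : ℕ) (γ : ℝ) (hγ : 0 < γ) (e : Set (EuclideanSpace ℝ (Fin n)))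
    (hb : Bornology.IsBounded e) (hne : e.Nonempty)
    (hz : ∃ z : EuclideanSpace ℝ (Fin n), Metric.ball z (Metric.diam e / γ) ⊆ e ∧
        ∀ x ∈ e, convexHull ℝ ({x} ∪ Metric.ball z (Metric.diam e / γ)) ⊆ e)
    (F : EuclideanSpace ℝ (Fin n) → ENNReal) (hF : Measurable F) :
    ∃ y ∈ e, (∀ x ∈ e, segment ℝ y x ⊆ e) ∧
      ∫⁻ x in e, ∫⁻ s in Set.Icc (0 : ℝ) 1, F (y + s • (x - y))
        ≤ ENNReal.ofReal (2 ^ n * (1 + γ ^ n)) * ∫⁻ x, F x := by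
  have hK : ENNReal.ofReal (2 ^ n * (1 + γ ^ n)) = 2 ^ n * (1 + ENNReal.ofReal (γ ^ n)) := by
    rw [ENNReal.ofReal_mul (by positivity), ENNReal.ofReal_pow (by norm_num),
      ENNReal.ofReal_add (by norm_num) (by positivity)]
    simp
  rcases (Metric.diam_nonneg (s := e)).eq_or_lt with hd | hd
  · obtain ⟨y, hy⟩ := hne
    have hsub : ∀ x ∈ e, x = y := by
      intro x hx
      have := Metric.dist_le_diam_of_mem hb hx hy
      rw [← hd] at this
      exact dist_le_zero.1 this
    have hey : e = {y} := Set.eq_singleton_iff_unique_mem.2 ⟨hy, hsub⟩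
    refine ⟨y, hy, ?_, ?_⟩
    · intro x hx
      rw [hsub x hx, segment_same]
      simpa using hy
    · calc _ = ∫⁻ x in e, F x := by
            rw [hey]
            refine setLIntegral_congr_fun (MeasurableSet.singleton y) ?_
            intro x hx
            have hx : x = y := hx
            simp [hx]
        _ ≤ ∫⁻ x, F x := setLIntegral_le_lintegral _ _
        _ ≤ _ := by
            refine le_mul_of_one_le_left zero_le ?_
            rw [ENNReal.one_le_ofReal]
            have : (1 : ℝ) ≤ 2 ^ n := one_le_pow₀ (by norm_num)
            have h2 : 0 ≤ γ ^ n := by positivity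
            nlinarith
  · obtain ⟨z, hzB, hst⟩ := hz
    have hr : 0 < Metric.diam e / γ := by positivity
    have hze : z ∈ e := hzB (Metric.mem_ball_self hr)
    have hnt : Nontrivial (EuclideanSpace ℝ (Fin n)) := by
      by_contra hcon
      rw [not_nontrivial_iff_subsingleton] at hcon
      have : e.Subsingleton := Set.subsingleton_of_subsingleton
      rw [Metric.diam_subsingleton this] at hd
      exact lt_irrefl _ hd
    have hvol : volume e ≤ ENNReal.ofReal (γ ^ n) *
        volume (Metric.ball z (Metric.diam e / γ)) := by
      have h1 : e ⊆ Metric.closedBall z (Metric.diam e) := fun x hx =>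
        Metric.dist_le_diam_of_mem hb hx hze
      refine (measure_mono h1).trans ?_
      rw [Measure.addHaar_closedBall _ _ hd.le, Measure.addHaar_ball _ _ hr.le, ← mul_assoc,
        ← ENNReal.ofReal_mul (by positivity), finrank_euclideanSpace_fin, ← mul_pow,
        mul_div_cancel₀ _ hγ.ne']
    obtain ⟨y, hy, hle⟩ := bh_avg n F hF (Metric.ball z (Metric.diam e / γ)) e
      (Metric.measure_ball_pos _ _ hr).ne' measure_ball_lt_top.ne _ hvol
    refine ⟨y, hzB hy, ?_, by rw [hK]; exact hle⟩
    intro x hx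
    refine Set.Subset.trans ?_ (hst x hx)
    exact (convex_convexHull ℝ _).segment_subset (subset_convexHull ℝ _ (Or.inr hy))
      (subset_convexHull ℝ _ (Or.inl rfl))

/-- Bramble–Hilbert estimate: for `m ≤ k+1` and `γ > 0` there is a constant `C`, depending
only on `n`, `k`, `γ`, such that every bounded open `e ⊆ ℝⁿ` that is star-shaped with
respect to a ball of radius `diam e / γ` contained in `e`, and every `u` of class `C^{k+1}`
near the closure of `e` with square-integrable `(k+1)`-st derivative, admits a polynomial
`P_e` of degree at most `k` with
`‖∇^m (u - P_e)‖_{L²(e)} ≤ C ⬝ (diam e)^{k+1-m} ⬝ ‖∇^{k+1} u‖_{L²(e)}`. -/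
theorem bramble_hilbert (n k : ℕ) (γ : ℝ) (hγ : 0 < γ) :
    ∃ C : ℝ, 0 < C ∧ ∀ m : ℕ, m ≤ k + 1 →
      ∀ e : Set (EuclideanSpace ℝ (Fin n)), IsOpen e → Bornology.IsBounded e →
      (∃ z : EuclideanSpace ℝ (Fin n), Metric.ball z (Metric.diam e / γ) ⊆ e ∧
        ∀ x ∈ e, convexHull ℝ ({x} ∪ Metric.ball z (Metric.diam e / γ)) ⊆ e) →
      ∀ u : EuclideanSpace ℝ (Fin n) → ℝ,
        (∃ U : Set (EuclideanSpace ℝ (Fin n)),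
          IsOpen U ∧ closure e ⊆ U ∧ ContDiffOn ℝ (↑(k + 1)) u U) →
        IntegrableOn (fun x => ‖iteratedFDeriv ℝ (k + 1) u x‖ ^ 2) e →
        ∃ P : MvPolynomial (Fin n) ℝ, P.totalDegree ≤ k ∧
          sobolevSeminorm n m e (fun x => u x - MvPolynomial.eval (fun i => x i) P)
            ≤ C * Metric.diam e ^ (k + 1 - m) * sobolevSeminorm n (k + 1) e u := by
  classical
  have hK1 : (1 : ℝ) ≤ 2 ^ n * (1 + γ ^ n) := by
    have : (1 : ℝ) ≤ 2 ^ n := one_le_pow₀ (by norm_num)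
    have h2 : 0 ≤ γ ^ n := by positivity
    nlinarith
  set K : ℝ := 2 ^ n * (1 + γ ^ n) with hKdef
  refine ⟨K, by linarith, ?_⟩
  rintro m hm e he hb hz u ⟨U, hU, heU, hu⟩ hint
  rcases e.eq_empty_or_nonempty with rfl | hne
  · exact ⟨0, by simp, by simp [sobolevSeminorm]⟩
  have huat : ∀ x ∈ e, ContDiffAt ℝ ((k + 1 : ℕ) : WithTop ℕ∞) u x := fun x hx =>
    hu.contDiffAt (hU.mem_nhds (heU (subset_closure hx)))
  have hcu : ContinuousOn (fun x => ENNReal.ofReal (‖iteratedFDeriv ℝ (k + 1) u x‖ ^ 2)) e := by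
    intro x hx
    have h1 : ContinuousAt (iteratedFDeriv ℝ (k + 1) u) x :=
      ((huat x hx).iteratedFDeriv_right (m := 0) (i := k + 1) (by simp)).continuousAt
    exact (ENNReal.continuous_ofReal.continuousAt.comp (h1.norm.pow 2)).continuousWithinAt
  set F : EuclideanSpace ℝ (Fin n) → ENNReal :=
    e.indicator (fun x => ENNReal.ofReal (‖iteratedFDeriv ℝ (k + 1) u x‖ ^ 2)) with hFdef
  have hF : Measurable F := by
    rw [hFdef, ← Set.piecewise_eq_indicator]
    exact hcu.measurable_piecewise continuousOn_const he.measurableSet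
  have hFint : ∫⁻ x, F x = ENNReal.ofReal (∫ x in e, ‖iteratedFDeriv ℝ (k + 1) u x‖ ^ 2) := by
    rw [hFdef, lintegral_indicator he.measurableSet, ofReal_integral_eq_lintegral_ofReal hint]
    exact Filter.Eventually.of_forall fun x => by positivity
  obtain ⟨y, hy, hseg, hle⟩ := bh_good_point n γ hγ e hb hne hz F hF
  obtain ⟨P, hPdeg, hPc, hPj, hP0⟩ := bh_taylor n k u y (huat y hy)
  refine ⟨P, hPdeg, ?_⟩
  set g : EuclideanSpace ℝ (Fin n) → ℝ := fun x => u x - MvPolynomial.eval (fun i => x i) P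
    with hgdef
  have hgat : ∀ x ∈ e, ContDiffAt ℝ ((k + 1 : ℕ) : WithTop ℕ∞) g x := fun x hx =>
    (huat x hx).sub hPc.contDiffAt
  have hgj : ∀ j ≤ k, iteratedFDeriv ℝ j g y = 0 := by
    intro j hj
    have hjk : (j : WithTop ℕ∞) ≤ ((k + 1 : ℕ) : WithTop ℕ∞) := by norm_cast; omega
    rw [hgdef, fun_iteratedFDeriv_sub_apply ((huat y hy).of_le hjk) (hPc.contDiffAt.of_le hjk),
      hPj j hj, sub_self]
  have hgk : ∀ x ∈ e, iteratedFDeriv ℝ (k + 1) g x = iteratedFDeriv ℝ (k + 1) u x := by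
    intro x hx
    rw [hgdef, fun_iteratedFDeriv_sub_apply (huat x hx) hPc.contDiffAt, hP0, sub_zero]
  have hI0 : 0 ≤ ∫ x in e, ‖iteratedFDeriv ℝ (k + 1) u x‖ ^ 2 :=
    integral_nonneg fun x => by positivity
  rcases hm.eq_or_lt with rfl | hmk
  · have : sobolevSeminorm n (k + 1) e g = sobolevSeminorm n (k + 1) e u := by
      unfold sobolevSeminorm
      congr 1
      refine setIntegral_congr_fun he.measurableSet fun x hx => ?_
      simp only [hgk x hx]
    rw [this, Nat.sub_self, pow_zero, mul_one]
    exact le_mul_of_one_le_left (Real.sqrt_nonneg _) hK1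
  · obtain ⟨i, hi, rfl⟩ : ∃ i ≤ k, m = k - i := ⟨k - m, by omega, by omega⟩
    have hexp : k + 1 - (k - i) = i + 1 := by omega
    rw [hexp]
    set h := Metric.diam e with hh
    have hh0 : 0 ≤ h := Metric.diam_nonneg
    have hpt : ∀ x ∈ e, ENNReal.ofReal (‖iteratedFDeriv ℝ (k - i) g x‖ ^ 2) ≤
        ENNReal.ofReal ((h ^ (i + 1)) ^ 2) *
          ∫⁻ s in Set.Icc (0 : ℝ) 1, F (y + s • (x - y)) := by
      intro x hx
      have hp := bh_pointwise k g x y (fun p hp => hgat p (hseg x hx hp)) hgj i hi x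
        (right_mem_segment ℝ y x)
      have hmem : ∀ s ∈ Set.Icc (0 : ℝ) 1, y + s • (x - y) ∈ e := by
        intro s hs
        apply hseg x hx
        rw [segment_eq_image']
        exact ⟨s, hs, rfl⟩
      have hcφ : ContinuousOn (fun s : ℝ => ‖iteratedFDeriv ℝ (k + 1) g (y + s • (x - y))‖)
          (Set.Icc 0 1) := by
        intro s hs
        have h1 : ContinuousAt (iteratedFDeriv ℝ (k + 1) g) (y + s • (x - y)) :=
          ((hgat _ (hmem s hs)).iteratedFDeriv_right (m := 0) (i := k + 1) (by simp)).continuousAt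
        exact (ContinuousAt.comp (f := fun s : ℝ => y + s • (x - y)) h1
          (by fun_prop)).norm.continuousWithinAt
      have hcs := bh_cs _ hcφ
      have hJ : ENNReal.ofReal (∫ s in (0 : ℝ)..1,
          ‖iteratedFDeriv ℝ (k + 1) g (y + s • (x - y))‖ ^ 2) =
          ∫⁻ s in Set.Icc (0 : ℝ) 1, F (y + s • (x - y)) := by
        rw [intervalIntegral.integral_of_le zero_le_one, ← integral_Icc_eq_integral_Ioc,
          ofReal_integral_eq_lintegral_ofReal]
        · refine setLIntegral_congr_fun measurableSet_Icc fun s hs => ?_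
          simp only [hFdef, Set.indicator_of_mem (hmem s hs), hgk _ (hmem s hs)]
        · exact (hcφ.pow 2).integrableOn_Icc
        · exact Filter.Eventually.of_forall fun x => by positivity
      rw [← hJ, ← ENNReal.ofReal_mul (by positivity)]
      refine ENNReal.ofReal_le_ofReal ?_
      have hxy : ‖x - y‖ ≤ h := by
        rw [← dist_eq_norm]; exact Metric.dist_le_diam_of_mem hb hx hy
      have hI : 0 ≤ ∫ s in (0 : ℝ)..1, ‖iteratedFDeriv ℝ (k + 1) g (y + s • (x - y))‖ :=
        intervalIntegral.integral_nonneg zero_le_one fun _ _ => norm_nonneg _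
      calc _ ≤ (‖x - y‖ ^ (i + 1) *
            ∫ s in (0 : ℝ)..1, ‖iteratedFDeriv ℝ (k + 1) g (y + s • (x - y))‖) ^ 2 := by
            gcongr
        _ = (‖x - y‖ ^ (i + 1)) ^ 2 *
            (∫ s in (0 : ℝ)..1, ‖iteratedFDeriv ℝ (k + 1) g (y + s • (x - y))‖) ^ 2 := by ring
        _ ≤ _ := by gcongr
    have hcg : ContinuousOn (fun x => ‖iteratedFDeriv ℝ (k - i) g x‖ ^ 2) e := by
      intro x hx
      have h1 : ContinuousAt (iteratedFDeriv ℝ (k - i) g) x :=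
        ((hgat x hx).iteratedFDeriv_right (m := 0) (i := k - i)
          (by rw [zero_add]; norm_cast)).continuousAt
      exact (h1.norm.pow 2).continuousWithinAt
    have hmain : ∫ x in e, ‖iteratedFDeriv ℝ (k - i) g x‖ ^ 2 ≤
        (h ^ (i + 1)) ^ 2 * (K * ∫ x in e, ‖iteratedFDeriv ℝ (k + 1) u x‖ ^ 2) := by
      rw [integral_eq_lintegral_of_nonneg_ae
        (Filter.Eventually.of_forall fun x => by positivity)
        (hcg.aestronglyMeasurable he.measurableSet)]
      refine ENNReal.toReal_le_of_le_ofReal (by positivity) ?_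
      calc _ ≤ ∫⁻ x in e, ENNReal.ofReal ((h ^ (i + 1)) ^ 2) *
            ∫⁻ s in Set.Icc (0 : ℝ) 1, F (y + s • (x - y)) :=
            setLIntegral_mono' he.measurableSet hpt
        _ = ENNReal.ofReal ((h ^ (i + 1)) ^ 2) *
            ∫⁻ x in e, ∫⁻ s in Set.Icc (0 : ℝ) 1, F (y + s • (x - y)) :=
            lintegral_const_mul' _ _ ENNReal.ofReal_ne_top
        _ ≤ ENNReal.ofReal ((h ^ (i + 1)) ^ 2) * (ENNReal.ofReal K * ∫⁻ x, F x) := by gcongr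
        _ = _ := by
            rw [hFint, ← ENNReal.ofReal_mul (by positivity), ← ENNReal.ofReal_mul (by positivity)]
    unfold sobolevSeminorm
    refine Real.sqrt_le_iff.2 ⟨by positivity, hmain.trans ?_⟩
    rw [mul_pow, mul_pow, Real.sq_sqrt hI0]
    have : K ≤ K ^ 2 := by nlinarith
    calc _ ≤ (h ^ (i + 1)) ^ 2 * (K ^ 2 * ∫ x in e, ‖iteratedFDeriv ℝ (k + 1) u x‖ ^ 2) := by
          gcongr
      _ = _ := by ring
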